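/- Let Y be a real Banach space, 0 < ε < 1, and (y₁,y₂,y₃,y₄) ∈ M_Y^4. If j ∈ {1,2,3,4} satisfies ‖y_j‖ > 1 − ε/6, then there exists (z₁,z₂,z₃,z₄) ∈ M_Y^4 such that ‖z_j‖ = 1 and ‖z_i − y_i‖ < ε for every 1 ≤ i ≤ 4. -/

import Mathlib

/-- `M_Y^4`: quadruples `(y₁,y₂,y₃,y₄)` in the closed unit ball of `Y` such that
`‖y_{i₁} − y_{i₂} + y_{i₃}‖ ≤ 1` for all `i₁ < i₂ < i₃`. -/
def MY4 {Y : Type*} [NormedAddCommGroup Y] (y : Fin 4 → Y) : Prop :=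
  (∀ i, ‖y i‖ ≤ 1) ∧
    ∀ i j k : Fin 4, i < j → j < k → ‖y i - y j + y k‖ ≤ 1

/-- Pulling a vector of the unit ball towards a vector of norm at most `1 / 2` by a convex-type
combination stays in the unit ball. -/
lemma norm_combination_le_one {Y : Type*} [NormedAddCommGroup Y] [NormedSpace ℝ Y]
    {v e : Y} {t b : ℝ} (ht0 : 0 ≤ t) (ht2 : t ≤ 2) (hv : ‖v‖ ≤ 1) (he : ‖e‖ = 1)
    (hb : |b| ≤ 1 / 2) : ‖(1 - t / 2) • v + (t * b) • e‖ ≤ 1 := by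
  refine (norm_add_le _ _).trans ?_
  rw [norm_smul, norm_smul, Real.norm_eq_abs, Real.norm_eq_abs, abs_mul, abs_of_nonneg ht0,
    abs_of_nonneg (by linarith : 0 ≤ 1 - t / 2), he]
  nlinarith [mul_le_mul_of_nonneg_left hb ht0,
    mul_le_mul_of_nonneg_left hv (by linarith : 0 ≤ 1 - t / 2)]

/-- A scalar quadruple with value `1` at `j` for which all other constraints defining `MY4` hold
with slack `1 / 2`. -/
lemma exists_slack_quadruple (j : Fin 4) : ∃ a : Fin 4 → ℝ, a j = 1 ∧
    (∀ i, i ≠ j → |a i| ≤ 1 / 2) ∧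
    ∀ i k l : Fin 4, i < k → k < l → |a i - a k + a l| ≤ 1 / 2 := by
  have key : ∀ p q r s : ℝ, |p - q + r| ≤ 1 / 2 → |p - q + s| ≤ 1 / 2 →
      |p - r + s| ≤ 1 / 2 → |q - r + s| ≤ 1 / 2 → ∀ i k l : Fin 4, i < k → k < l →
      |![p, q, r, s] i - ![p, q, r, s] k + ![p, q, r, s] l| ≤ 1 / 2 := by
    intro p q r s h₁ h₂ h₃ h₄ i k l hik hkl
    fin_cases i <;> fin_cases k <;> first
      | exact absurd hik (by decide)
      | (fin_cases l <;> first
          | exact absurd hkl (by decide)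
          | assumption)
  fin_cases j
  · refine ⟨![1, 1 / 2, 0, -1 / 2], by simp, ?_, key _ _ _ _ ?_ ?_ ?_ ?_⟩
    · intro i hi
      fin_cases i <;> first
        | exact absurd rfl hi
        | norm_num [abs_le]
    all_goals norm_num [abs_le]
  · refine ⟨![1 / 2, 1, 1 / 2, 0], by simp, ?_, key _ _ _ _ ?_ ?_ ?_ ?_⟩
    · intro i hi
      fin_cases i <;> first
        | exact absurd rfl hi
        | norm_num [abs_le]
    all_goals norm_num [abs_le]
  · refine ⟨![0, 1 / 2, 1, 1 / 2], by simp, ?_, key _ _ _ _ ?_ ?_ ?_ ?_⟩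
    · intro i hi
      fin_cases i <;> first
        | exact absurd rfl hi
        | norm_num [abs_le]
    all_goals norm_num [abs_le]
  · refine ⟨![-1 / 2, 0, 1 / 2, 1], by simp, ?_, key _ _ _ _ ?_ ?_ ?_ ?_⟩
    · intro i hi
      fin_cases i <;> first
        | exact absurd rfl hi
        | norm_num [abs_le]
    all_goals norm_num [abs_le]

/-- If `(y₁,y₂,y₃,y₄) ∈ M_Y^4` and `‖y_j‖ > 1 − ε/6` for some index `j`, then there is
`(z₁,z₂,z₃,z₄) ∈ M_Y^4` with `‖z_j‖ = 1` and `‖z_i − y_i‖ < ε` for all `i`. -/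
theorem stmt4 (Y : Type*) [NormedAddCommGroup Y] [NormedSpace ℝ Y] [CompleteSpace Y]
    (ε : ℝ) (hε0 : 0 < ε) (hε1 : ε < 1)
    (y : Fin 4 → Y) (hy : MY4 y) (j : Fin 4) (hj : 1 - ε / 6 < ‖y j‖) :
    ∃ z : Fin 4 → Y, MY4 z ∧ ‖z j‖ = 1 ∧ ∀ i, ‖z i - y i‖ < ε := by
  obtain ⟨a, haj, ha, ha₃⟩ := exists_slack_quadruple j
  obtain ⟨hy₁, hy₃⟩ := hy
  obtain ⟨s, hs⟩ : ∃ s, s = ‖y j‖ := ⟨_, rfl⟩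
  have hs1 : s ≤ 1 := hs ▸ hy₁ j
  rw [← hs] at hj
  have hs0 : 0 < s := by linarith
  obtain ⟨e, he⟩ : ∃ e, e = s⁻¹ • y j := ⟨_, rfl⟩
  have hye : y j = s • e := by rw [he, smul_inv_smul₀ hs0.ne']
  have he1 : ‖e‖ = 1 := by
    rw [he, norm_smul, ← hs, norm_inv, Real.norm_of_nonneg hs0.le, inv_mul_cancel₀ hs0.ne']
  obtain ⟨t, ht⟩ : ∃ t, t = (1 - s) / (1 - s / 2) := ⟨_, rfl⟩
  have hts : t * (1 - s / 2) = 1 - s := by rw [ht, div_mul_cancel₀ _ (by linarith)]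
  have ht0 : 0 ≤ t := ht ▸ div_nonneg (by linarith) (by linarith)
  have htε : t < ε / 3 := by nlinarith
  have hzj : (1 - t / 2) • y j + (t * a j) • e = e := by
    rw [hye, smul_smul, ← add_smul, haj,
      show (1 - t / 2) * s + t * 1 = 1 by linear_combination hts, one_smul]
  refine ⟨fun i => (1 - t / 2) • y i + (t * a i) • e, ⟨fun i => ?_, fun i k l hik hkl => ?_⟩,
    ?_, fun i => ?_⟩
  · rcases eq_or_ne i j with rfl | hij
    · exact (congrArg norm hzj).trans he1 |>.le
    · exact norm_combination_le_one ht0 (by linarith) (hy₁ i) he1 (ha i hij)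
  · have h := norm_combination_le_one ht0 (by linarith) (hy₃ i k l hik hkl) he1
      (ha₃ i k l hik hkl)
    convert h using 2
    module
  · exact (congrArg norm hzj).trans he1
  · have hai : |a i| ≤ 1 := by
      rcases eq_or_ne i j with rfl | hij
      · simp [haj]
      · linarith [ha i hij]
    have hz : (1 - t / 2) • y i + (t * a i) • e - y i = (t * a i) • e - (t / 2) • y i := by
      module
    calc ‖(1 - t / 2) • y i + (t * a i) • e - y i‖
        ≤ ‖(t * a i) • e‖ + ‖(t / 2) • y i‖ := hz ▸ norm_sub_le _ _
      _ = t * |a i| + t / 2 * ‖y i‖ := by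
        rw [norm_smul, norm_smul, he1, Real.norm_eq_abs, Real.norm_eq_abs, abs_mul,
          abs_of_nonneg ht0, abs_of_nonneg (by linarith : 0 ≤ t / 2), mul_one]
      _ < ε := by
        nlinarith [mul_le_mul_of_nonneg_left hai ht0, mul_le_mul_of_nonneg_left (hy₁ i) ht0]
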